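/- Every maximal solution of the collinear three-particle Hamiltonian system is global: for every initial condition (q⁰,p⁰) ∈ ℝ³ × ℝ³ with q⁰₁ < q⁰₂ < q⁰₃ there is a unique solution t ↦ (q(t),p(t)) of q̇ = M⁻¹p, ṗ = −∇W(q) with (q(0),p(0)) = (q⁰,p⁰) defined for all t ∈ ℝ, and it satisfies q₁(t) < q₂(t) < q₃(t) for all t ∈ ℝ (in particular, no solution experiences a singularity in finite time). -/

import Mathlib

open Real

/-- Global existence for a time dependent field which is bounded and Lipschitz on bounded time intervals. -/
theorem aux_global_exists {E : Type*} [NormedAddCommGroup E] [NormedSpace ℝ E] [CompleteSpace E]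
    (v : ℝ → E → E) (x0 : E)
    (hL : ∀ T : ℝ, 0 < T → ∃ K : NNReal, ∀ t ∈ Set.Icc (-T) T, LipschitzWith K (v t))
    (hB : ∀ T : ℝ, 0 < T → ∃ B : NNReal, ∀ t ∈ Set.Icc (-T) T, ∀ x, ‖v t x‖ ≤ B)
    (hc : ∀ x, Continuous (fun t => v t x)) :
    ∃ γ : ℝ → E, γ 0 = x0 ∧ ∀ t, HasDerivAt γ (v t (γ t)) t := by
  have key : ∀ T : ℝ, 0 < T → ∃ γ : ℝ → E, γ 0 = x0 ∧
      ∀ t ∈ Set.Ioo (-T) T, HasDerivAt γ (v t (γ t)) t := by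
    intro T hT
    obtain ⟨K, hK⟩ := hL T hT
    obtain ⟨B, hB⟩ := hB T hT
    have hpl : IsPicardLindelof v (tmin := -T) (tmax := T) ⟨0, by constructor <;> linarith⟩ x0
        (B * T.toNNReal) 0 B K := by
      refine ⟨fun t ht => (hK t ht).lipschitzOnWith, fun x _ => (hc x).continuousOn,
        fun t ht x _ => hB t ht x, ?_⟩
      simp [hT.le]
    obtain ⟨γ, h0, h1⟩ := hpl.exists_eq_forall_mem_Icc_hasDerivWithinAt₀
    exact ⟨γ, h0, fun t ht => (h1 t (Set.Ioo_subset_Icc_self ht)).hasDerivAt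
      (Icc_mem_nhds ht.1 ht.2)⟩
  choose! γ h0 h1 using key
  have huniq : ∀ S T : ℝ, 0 < S → S ≤ T → ∀ t ∈ Set.Ioo (-S) S, γ S t = γ T t := by
    intro S T hS hST
    obtain ⟨K, hK⟩ := hL S hS
    have := ODE_solution_unique_of_mem_Ioo (v := v) (s := fun _ => Set.univ) (K := K)
      (f := γ S) (g := γ T) (a := -S) (b := S) (t₀ := 0)
      (fun t ht => (hK t (Set.Ioo_subset_Icc_self ht)).lipschitzOnWith)
      (by constructor <;> linarith)
      (fun t ht => ⟨h1 S hS t ht, trivial⟩)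
      (fun t ht => ⟨h1 T (by linarith) t ⟨by linarith [ht.1], by linarith [ht.2]⟩, trivial⟩)
      (by rw [h0 S hS, h0 T (by linarith)])
    exact this
  have hpos : ∀ t : ℝ, 0 < |t| + 1 := fun t => by positivity
  refine ⟨fun t => γ (|t| + 1) t, h0 _ (hpos 0), fun t => ?_⟩
  have hmem : ∀ s : ℝ, s ∈ Set.Ioo (-(|s| + 1)) (|s| + 1) := fun s =>
    ⟨by linarith [neg_abs_le s], by linarith [le_abs_self s]⟩
  have hev : (fun s => γ (|s| + 1) s) =ᶠ[nhds t] γ (|t| + 1) := by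
    filter_upwards [Ioo_mem_nhds (hmem t).1 (hmem t).2] with s hs
    rcases le_total (|s| + 1) (|t| + 1) with h | h
    · exact huniq _ _ (hpos s) h s (hmem s)
    · exact (huniq _ _ (hpos t) h s hs).symm
  exact (h1 _ (hpos t) t (hmem t)).congr_of_eventuallyEq hev

/-- Global existence for second order systems with a bounded Lipschitz force. -/
theorem aux_second_order {E : Type*} [NormedAddCommGroup E] [NormedSpace ℝ E] [CompleteSpace E]
    (D : E →L[ℝ] E) (F : E → E) (K : NNReal) (hK : LipschitzWith K F) (B : NNReal)
    (hB : ∀ x, ‖F x‖ ≤ B) (q0 p0 : E) :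
    ∃ q p : ℝ → E, q 0 = q0 ∧ p 0 = p0 ∧ (∀ t, HasDerivAt q (D (p t)) t) ∧
      ∀ t, HasDerivAt p (F (q t)) t := by
  let v : ℝ → E × E → E × E := fun t x =>
    (-(t • D (F (x.1 + t • D x.2))), F (x.1 + t • D x.2))
  have hex : ∃ γ : ℝ → E × E, γ 0 = (q0, p0) ∧ ∀ t, HasDerivAt γ (v t (γ t)) t := by
    refine aux_global_exists v (q0, p0) ?_ ?_ ?_
    · intro T hT
      refine ⟨(T.toNNReal * ‖D‖₊ + 1) * (K * (1 + T.toNNReal * ‖D‖₊)), fun t ht =>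
        LipschitzWith.of_dist_le_mul fun x y => ?_⟩
      have ht' : |t| ≤ T := abs_le.mpr ht
      have e1 : ‖F (x.1 + t • D x.2) - F (y.1 + t • D y.2)‖ ≤ K * ((1 + T * ‖D‖) * ‖x - y‖) := by
        have := hK.dist_le_mul (x.1 + t • D x.2) (y.1 + t • D y.2)
        rw [dist_eq_norm, dist_eq_norm] at this
        refine this.trans ?_
        gcongr
        have : x.1 + t • D x.2 - (y.1 + t • D y.2) = (x - y).1 + t • D (x - y).2 := by
          simp [smul_sub]; abel
        rw [this]
        refine (norm_add_le _ _).trans ?_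
        rw [norm_smul, Real.norm_eq_abs]
        have a1 := norm_fst_le (x - y)
        have a2 : |t| * ‖D (x - y).2‖ ≤ T * (‖D‖ * ‖x - y‖) := by
          gcongr
          exact (D.le_opNorm _).trans (by gcongr; exact norm_snd_le (x - y))
        linarith
      rw [dist_eq_norm, dist_eq_norm]
      push_cast
      rw [Real.coe_toNNReal _ hT.le]
      set R := K * ((1 + T * ‖D‖) * ‖x - y‖) with hR
      have hR0 : 0 ≤ R := (norm_nonneg _).trans e1
      have hn := norm_nonneg D
      have e2 : (T * ‖D‖ + 1) * (K * (1 + T * ‖D‖)) * ‖x - y‖ = T * (‖D‖ * R) + R := by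
        rw [hR]; ring
      rw [e2]
      refine norm_prod_le_iff.mpr ⟨?_, ?_⟩
      · have : (v t x - v t y).1 = -(t • D (F (x.1 + t • D x.2) - F (y.1 + t • D y.2))) := by
          simp [v, smul_sub]; abel
        rw [this, norm_neg, norm_smul, Real.norm_eq_abs]
        have : |t| * ‖D (F (x.1 + t • D x.2) - F (y.1 + t • D y.2))‖ ≤ T * (‖D‖ * R) := by
          gcongr
          exact (D.le_opNorm _).trans (by gcongr)
        linarith
      · have : 0 ≤ T * (‖D‖ * R) := by positivity
        simp only [v, Prod.snd_sub]
        linarith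
    · intro T hT
      refine ⟨T.toNNReal * (‖D‖₊ * B) + B, fun t ht x => ?_⟩
      have ht' : |t| ≤ T := abs_le.mpr ht
      push_cast
      rw [Real.coe_toNNReal _ hT.le]
      refine norm_prod_le_iff.mpr ⟨?_, ?_⟩
      · simp only [v]
        rw [norm_neg, norm_smul, Real.norm_eq_abs]
        have : |t| * ‖D (F (x.1 + t • D x.2))‖ ≤ T * (‖D‖ * B) := by
          gcongr
          exact (D.le_opNorm _).trans (by gcongr; exact hB _)
        have := B.coe_nonneg
        linarith
      · have : 0 ≤ T * (‖D‖ * (B:ℝ)) := by positivity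
        have := hB (x.1 + t • D x.2)
        simp only [v]
        linarith
    · intro x
      have := hK.continuous
      simp only [v]
      fun_prop
  obtain ⟨γ, h0, h1⟩ := hex
  have hq : ∀ t, HasDerivAt (fun t => (γ t).1) (-(t • D (F ((γ t).1 + t • D (γ t).2)))) t :=
    fun t => (h1 t).fst
  have hp : ∀ t, HasDerivAt (fun t => (γ t).2) (F ((γ t).1 + t • D (γ t).2)) t :=
    fun t => (h1 t).snd
  refine ⟨fun t => (γ t).1 + t • D (γ t).2, fun t => (γ t).2, by simp [h0], by simp [h0],
    fun t => ?_, fun t => hp t⟩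
  have h2 := (hq t).add ((hasDerivAt_id t).smul (D.hasFDerivAt.comp_hasDerivAt t (hp t)))
  refine h2.congr_deriv ?_
  simp

noncomputable def auxPhi (a b α β r : ℝ) : ℝ := -(α * |r| ^ (-a)) + β * |r| ^ (-b)
noncomputable def auxDphi (a b α β r : ℝ) : ℝ := α * a * r ^ (-a - 1) - β * b * r ^ (-b - 1)

theorem aux_hasDerivAt_phi (a b α β r : ℝ) (hr : 0 < r) :
    HasDerivAt (auxPhi a b α β) (auxDphi a b α β r) r := by
  have h1 := (Real.hasDerivAt_rpow_const (x := r) (p := -a) (Or.inl hr.ne'))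
  have h2 := (Real.hasDerivAt_rpow_const (x := r) (p := -b) (Or.inl hr.ne'))
  have h := ((h1.const_mul α).neg).add (h2.const_mul β)
  have h' : HasDerivAt (fun r => -(α * r ^ (-a)) + β * r ^ (-b)) (auxDphi a b α β r) r :=
    h.congr_deriv (by unfold auxDphi; ring)
  refine h'.congr_of_eventuallyEq ?_
  filter_upwards [lt_mem_nhds hr] with s hs
  simp [auxPhi, abs_of_pos hs]

theorem aux_small (a b α β : ℝ) (ha : 0 < a) (hab : a < b) (hβ : 0 < β) (A ρ : ℝ)
    (hρ : 0 < ρ) :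
    ∃ d > 0, d ≤ ρ ∧ ∀ r, 0 < r → r ≤ d → A < auxPhi a b α β r ∧ auxDphi a b α β r < 0 := by
  have t0 : Filter.Tendsto (fun r : ℝ => r ^ (b - a)) (nhdsWithin 0 (Set.Ioi 0)) (nhds 0) := by
    have := (Real.continuousAt_rpow_const (0:ℝ) (b - a) (Or.inr (by linarith))).tendsto
    rw [Real.zero_rpow (by linarith)] at this
    exact this.mono_left nhdsWithin_le_nhds
  have t1 : Filter.Tendsto (fun r : ℝ => r ^ (-b)) (nhdsWithin 0 (Set.Ioi 0)) Filter.atTop :=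
    tendsto_rpow_neg_nhdsGT_zero (by linarith)
  have t2 : Filter.Tendsto (fun r : ℝ => β - α * r ^ (b - a)) (nhdsWithin 0 (Set.Ioi 0))
      (nhds β) := by
    simpa using tendsto_const_nhds.sub (t0.const_mul α)
  have t3 : Filter.Tendsto (fun r : ℝ => β * b - α * a * r ^ (b - a))
      (nhdsWithin 0 (Set.Ioi 0)) (nhds (β * b)) := by
    simpa using tendsto_const_nhds.sub (t0.const_mul (α * a))
  have t4 := t1.atTop_mul_pos hβ t2
  have ev := (t4.eventually_gt_atTop A).and
    (t3.eventually (lt_mem_nhds (show 0 < β * b by nlinarith)))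
  obtain ⟨u, hu, hsub⟩ := mem_nhdsGT_iff_exists_Ioo_subset.mp ev
  have hu : 0 < u := hu
  refine ⟨min ρ (u / 2), by positivity, min_le_left _ _, fun r hr hrd => ?_⟩
  have hru : r < u := by linarith [hrd.trans (min_le_right _ _)]
  obtain ⟨k1, k2⟩ := hsub ⟨hr, hru⟩
  have e1 : r ^ (-a) = r ^ (-b) * r ^ (b - a) := by
    rw [← Real.rpow_add hr]; ring_nf
  have e2 : r ^ (-a - 1) = r ^ (-b - 1) * r ^ (b - a) := by
    rw [← Real.rpow_add hr]; ring_nf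
  constructor
  · unfold auxPhi
    rw [abs_of_pos hr, e1]
    linarith
  · unfold auxDphi
    rw [e2]
    have := Real.rpow_pos_of_pos hr (-b - 1)
    nlinarith [mul_pos this k2]

theorem aux_lip (s d : ℝ) (hs : 0 < s) (hd : 0 < d) :
    ∃ K, LipschitzWith K (fun r : ℝ => (max r d) ^ (-s)) := by
  have h : LipschitzOnWith (s * d ^ (-s - 1)).toNNReal (fun r : ℝ => r ^ (-s)) (Set.Ici d) := by
    refine (convex_Ici d).lipschitzOnWith_of_nnnorm_hasDerivWithin_le
      (f' := fun r => (-s) * r ^ (-s - 1)) ?_ ?_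
    · intro r hr
      have : 0 < r := lt_of_lt_of_le hd hr
      exact (Real.hasDerivAt_rpow_const (Or.inl this.ne')).hasDerivWithinAt
    · intro r hr
      have h0 : 0 < r := lt_of_lt_of_le hd hr
      rw [← NNReal.coe_le_coe, coe_nnnorm, Real.coe_toNNReal _ (by positivity), Real.norm_eq_abs,
        abs_mul, abs_neg, abs_of_pos hs, abs_of_pos (Real.rpow_pos_of_pos h0 _)]
      gcongr ?_ * ?_
      exact Real.rpow_le_rpow_of_nonpos hd hr (by linarith)
  have h2 : LipschitzWith 1 (fun r : ℝ => max r d) := LipschitzWith.id.max_const d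
  have h3 := h.comp (h2.lipschitzOnWith (s := Set.univ)) (fun r _ => le_max_right r d)
  exact ⟨_, lipschitzOnWith_univ.mp h3⟩

theorem aux_pair (a b α β : ℝ) (ha : 0 < a) (hab : a < b) (hα : 0 < α) (hβ : 0 < β) :
    ∃ C, 0 ≤ C ∧ (∀ r, 0 < r → -C ≤ auxPhi a b α β r) ∧ ∀ A ρ : ℝ, 0 < ρ →
      ∃ d > 0, d ≤ ρ ∧ (∀ r, 0 < r → r ≤ d → A < auxPhi a b α β r) ∧ ∃ ψ g : ℝ → ℝ,
        (∀ r, HasDerivAt ψ (g r) r) ∧ (∀ r, -C ≤ ψ r) ∧ (∀ r ≤ d, A < ψ r) ∧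
        (∀ r ≥ d, ψ r = auxPhi a b α β r) ∧ (∀ r ≥ d, g r = auxDphi a b α β r) ∧
        (∃ K, LipschitzWith K g) ∧ ∃ B, ∀ r, |g r| ≤ B := by
  obtain ⟨d0, hd0, -, h0⟩ := aux_small a b α β ha hab hβ 0 1 one_pos
  have hC : ∀ r, 0 < r → -(α * d0 ^ (-a)) ≤ auxPhi a b α β r := by
    intro r hr
    have p1 := Real.rpow_pos_of_pos hd0 (-a)
    rcases le_total r d0 with h | h
    · have := (h0 r hr h).1
      nlinarith [mul_pos hα p1]
    · have p2 := Real.rpow_pos_of_pos hr (-b)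
      have := Real.rpow_le_rpow_of_nonpos hd0 h (show -a ≤ 0 by linarith)
      unfold auxPhi
      rw [abs_of_pos hr]
      nlinarith [mul_pos hβ p2]
  refine ⟨α * d0 ^ (-a), by positivity, hC, fun A ρ hρ => ?_⟩
  obtain ⟨d, hd, hdρ, h1⟩ := aux_small a b α β ha hab hβ A ρ hρ
  refine ⟨d, hd, hdρ, fun r hr hrd => (h1 r hr hrd).1, ?_⟩
  set g : ℝ → ℝ := fun r => auxDphi a b α β (max r d) with hg
  obtain ⟨K1, hK1⟩ := aux_lip (a + 1) d (by linarith) hd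
  obtain ⟨K2, hK2⟩ := aux_lip (b + 1) d (by linarith) hd
  have hgl : ∃ K, LipschitzWith K g := by
    have := ((lipschitzWith_smul (α * a)).comp hK1).sub ((lipschitzWith_smul (β * b)).comp hK2)
    refine ⟨‖α * a‖₊ * K1 + ‖β * b‖₊ * K2, fun x y => ?_⟩
    have h := this x y
    simp only [Function.comp_apply, smul_eq_mul, neg_add'] at h
    simpa only [hg, auxDphi] using h
  obtain ⟨K, hK⟩ := hgl
  have hgc := hK.continuous
  have hψ : ∀ r, HasDerivAt (fun r => auxPhi a b α β d + ∫ s in d..r, g s) (g r) r := fun r =>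
    (intervalIntegral.integral_hasDerivAt_right (hgc.intervalIntegrable _ _)
      (hgc.stronglyMeasurableAtFilter _ _) hgc.continuousAt).const_add _
  have hgt : ∀ r ≥ d, g r = auxDphi a b α β r := fun r hr => by simp [hg, max_eq_left hr]
  have hlow : ∀ r ≤ d, auxPhi a b α β d ≤ auxPhi a b α β d + ∫ s in d..r, g s := by
    intro r hr
    have : ∫ s in d..r, g s = ∫ s in d..r, auxDphi a b α β d := by
      apply intervalIntegral.integral_congr
      intro s hs
      rw [Set.uIcc_of_ge hr] at hs
      simp [hg, max_eq_right hs.2]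
    rw [this]
    have := (h1 d hd le_rfl).2
    simp
    nlinarith
  have hhigh : ∀ r ≥ d, auxPhi a b α β d + ∫ s in d..r, g s = auxPhi a b α β r := by
    intro r hr
    rw [intervalIntegral.integral_eq_sub_of_hasDerivAt (f := auxPhi a b α β) _
      (hgc.intervalIntegrable _ _)]
    · ring
    · intro s hs
      rw [Set.uIcc_of_le hr] at hs
      rw [hgt s hs.1]
      exact aux_hasDerivAt_phi a b α β s (by linarith [hs.1])
  refine ⟨_, g, hψ, ?_, ?_, hhigh, hgt, ⟨K, hK⟩, ?_⟩
  · intro r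
    rcases le_total r d with h | h
    · exact (hC d hd).trans (hlow r h)
    · show _ ≤ _ + _
      rw [hhigh r h]
      exact hC r (by linarith)
  · intro r hr
    exact lt_of_lt_of_le (h1 d hd le_rfl).1 (hlow r hr)
  · have hb : 0 < b := by linarith
    refine ⟨α * a * d ^ (-a - 1) + β * b * d ^ (-b - 1), fun r => ?_⟩
    have hm : d ≤ max r d := le_max_right _ _
    have hm0 : 0 < max r d := lt_of_lt_of_le hd hm
    simp only [hg, auxDphi]
    refine (abs_sub _ _).trans ?_
    rw [abs_of_nonneg (by positivity), abs_of_nonneg (by positivity)]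
    gcongr ?_ * ?_ + ?_ * ?_
    · exact Real.rpow_le_rpow_of_nonpos hd hm (by linarith)
    · exact Real.rpow_le_rpow_of_nonpos hd hm (by linarith)

/-- Conservation of energy. -/
theorem aux_energy (m1 m2 m3 : ℝ) (hm1 : 0 < m1) (hm2 : 0 < m2) (hm3 : 0 < m3)
    (ψ1 ψ2 ψ3 g1 g2 g3 : ℝ → ℝ) (q p : ℝ → Fin 3 → ℝ)
    (hψ1 : ∀ t, HasDerivAt ψ1 (g1 (q t 1 - q t 0)) (q t 1 - q t 0))
    (hψ2 : ∀ t, HasDerivAt ψ2 (g2 (q t 2 - q t 0)) (q t 2 - q t 0))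
    (hψ3 : ∀ t, HasDerivAt ψ3 (g3 (q t 2 - q t 1)) (q t 2 - q t 1))
    (hq : ∀ t i, HasDerivAt (fun τ => q τ i) (p t i / ![m1, m2, m3] i) t)
    (hp0 : ∀ t, HasDerivAt (fun τ => p τ 0) (g1 (q t 1 - q t 0) + g2 (q t 2 - q t 0)) t)
    (hp1 : ∀ t, HasDerivAt (fun τ => p τ 1) (-g1 (q t 1 - q t 0) + g3 (q t 2 - q t 1)) t)
    (hp2 : ∀ t, HasDerivAt (fun τ => p τ 2) (-g2 (q t 2 - q t 0) - g3 (q t 2 - q t 1)) t)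
    (t : ℝ) :
    p t 0 ^ 2 / (2 * m1) + p t 1 ^ 2 / (2 * m2) + p t 2 ^ 2 / (2 * m3)
      + (ψ1 (q t 1 - q t 0) + ψ2 (q t 2 - q t 0) + ψ3 (q t 2 - q t 1)) =
    p 0 0 ^ 2 / (2 * m1) + p 0 1 ^ 2 / (2 * m2) + p 0 2 ^ 2 / (2 * m3)
      + (ψ1 (q 0 1 - q 0 0) + ψ2 (q 0 2 - q 0 0) + ψ3 (q 0 2 - q 0 1)) := by
  have hd : ∀ t, HasDerivAt (fun t => p t 0 ^ 2 / (2 * m1) + p t 1 ^ 2 / (2 * m2)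
      + p t 2 ^ 2 / (2 * m3)
      + (ψ1 (q t 1 - q t 0) + ψ2 (q t 2 - q t 0) + ψ3 (q t 2 - q t 1))) 0 t := by
    intro t
    have q0 : HasDerivAt (fun τ => q τ 0) (p t 0 / m1) t := hq t 0
    have q1 : HasDerivAt (fun τ => q τ 1) (p t 1 / m2) t := hq t 1
    have q2 : HasDerivAt (fun τ => q τ 2) (p t 2 / m3) t := hq t 2
    have e1 := HasDerivAt.comp (h₂ := ψ1) t (hψ1 t) (q1.sub q0)
    have e2 := HasDerivAt.comp (h₂ := ψ2) t (hψ2 t) (q2.sub q0)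
    have e3 := HasDerivAt.comp (h₂ := ψ3) t (hψ3 t) (q2.sub q1)
    have h := (((((hp0 t).pow 2).div_const (2 * m1)).add (((hp1 t).pow 2).div_const (2 * m2))).add
      (((hp2 t).pow 2).div_const (2 * m3))).add ((e1.add e2).add e3)
    refine h.congr_deriv ?_
    field_simp
    ring
  exact is_const_of_deriv_eq_zero (fun t => (hd t).differentiableAt) (fun t => (hd t).deriv) t 0

/-- The force field. -/
noncomputable def auxF (g1 g2 g3 : ℝ → ℝ) (q : Fin 3 → ℝ) : Fin 3 → ℝ :=
  ![g1 (q 1 - q 0) + g2 (q 2 - q 0), -g1 (q 1 - q 0) + g3 (q 2 - q 1),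
    -g2 (q 2 - q 0) - g3 (q 2 - q 1)]

theorem aux_F_lip (g1 g2 g3 : ℝ → ℝ) (h1 : ∃ K, LipschitzWith K g1)
    (h2 : ∃ K, LipschitzWith K g2) (h3 : ∃ K, LipschitzWith K g3) :
    ∃ K, LipschitzWith K (auxF g1 g2 g3) := by
  obtain ⟨K1, h1⟩ := h1
  obtain ⟨K2, h2⟩ := h2
  obtain ⟨K3, h3⟩ := h3
  have key : ∀ (K : NNReal) (g : ℝ → ℝ), LipschitzWith K g → ∀ (i j : Fin 3)
      (x y : Fin 3 → ℝ), |g (x i - x j) - g (y i - y j)| ≤ K * (2 * dist x y) := by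
    intro K g hg i j x y
    have := hg.dist_le_mul (x i - x j) (y i - y j)
    rw [Real.dist_eq] at this
    refine this.trans ?_
    gcongr
    have a1 := dist_le_pi_dist x y i
    have a2 := dist_le_pi_dist x y j
    rw [Real.dist_eq] at *
    rw [abs_le] at *
    constructor <;> linarith
  refine ⟨2 * (K1 + K2 + K3), LipschitzWith.of_dist_le_mul fun x y => ?_⟩
  have k1 := abs_le.mp (key K1 g1 h1 1 0 x y)
  have k2 := abs_le.mp (key K2 g2 h2 2 0 x y)
  have k3 := abs_le.mp (key K3 g3 h3 2 1 x y)
  have d0 : 0 ≤ dist x y := dist_nonneg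
  have n1 := mul_nonneg K1.coe_nonneg d0
  have n2 := mul_nonneg K2.coe_nonneg d0
  have n3 := mul_nonneg K3.coe_nonneg d0
  push_cast
  rw [dist_pi_le_iff (by positivity)]
  intro i
  rw [Real.dist_eq, abs_le]
  fin_cases i <;> simp [auxF] <;> constructor <;> linarith

theorem aux_F_bdd (g1 g2 g3 : ℝ → ℝ) (h1 : ∃ B, ∀ r, |g1 r| ≤ B)
    (h2 : ∃ B, ∀ r, |g2 r| ≤ B) (h3 : ∃ B, ∀ r, |g3 r| ≤ B) :
    ∃ B : NNReal, ∀ x, ‖auxF g1 g2 g3 x‖ ≤ B := by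
  obtain ⟨B1, h1⟩ := h1
  obtain ⟨B2, h2⟩ := h2
  obtain ⟨B3, h3⟩ := h3
  have p1 := (abs_nonneg _).trans (h1 0)
  have p2 := (abs_nonneg _).trans (h2 0)
  have p3 := (abs_nonneg _).trans (h3 0)
  refine ⟨(B1 + B2 + B3).toNNReal, fun x => ?_⟩
  rw [Real.coe_toNNReal _ (by positivity), pi_norm_le_iff_of_nonneg (by positivity)]
  intro i
  have k1 := abs_le.mp (h1 (x 1 - x 0))
  have k2 := abs_le.mp (h2 (x 2 - x 0))
  have k3 := abs_le.mp (h3 (x 2 - x 1))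
  rw [Real.norm_eq_abs, abs_le]
  fin_cases i <;> simp [auxF] <;> constructor <;> linarith

theorem aux_fderiv (a b α12 α13 α23 β12 β13 β23 : ℝ) (W : (Fin 3 → ℝ) → ℝ)
    (hW : ∀ q : Fin 3 → ℝ,
      W q = -(α12 * |q 0 - q 1| ^ (-a) + α13 * |q 0 - q 2| ^ (-a)
              + α23 * |q 1 - q 2| ^ (-a))
            + (β12 * |q 0 - q 1| ^ (-b) + β13 * |q 0 - q 2| ^ (-b)
              + β23 * |q 1 - q 2| ^ (-b)))
    (q : Fin 3 → ℝ) (h01 : q 0 < q 1) (h12 : q 1 < q 2) (i : Fin 3) :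
    -(fderiv ℝ W q (Pi.single i 1)) =
      auxF (auxDphi a b α12 β12) (auxDphi a b α13 β13) (auxDphi a b α23 β23) q i := by
  have hWe : W = fun q => auxPhi a b α12 β12 (q 1 - q 0) + auxPhi a b α13 β13 (q 2 - q 0)
      + auxPhi a b α23 β23 (q 2 - q 1) := by
    funext q
    rw [hW, abs_sub_comm (q 0) (q 1), abs_sub_comm (q 0) (q 2), abs_sub_comm (q 1) (q 2)]
    simp only [auxPhi]
    ring
  have hl : ∀ i j : Fin 3, HasFDerivAt (fun x : Fin 3 → ℝ => x i - x j)
      (ContinuousLinearMap.proj (R := ℝ) (φ := fun _ : Fin 3 => ℝ) i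
        - ContinuousLinearMap.proj (R := ℝ) (φ := fun _ : Fin 3 => ℝ) j) q :=
    fun i j => (hasFDerivAt_apply (𝕜 := ℝ) i q).sub (hasFDerivAt_apply (𝕜 := ℝ) j q)
  have e1 := (aux_hasDerivAt_phi a b α12 β12 (q 1 - q 0) (by linarith)).comp_hasFDerivAt q (hl 1 0)
  have e2 := (aux_hasDerivAt_phi a b α13 β13 (q 2 - q 0) (by linarith)).comp_hasFDerivAt q (hl 2 0)
  have e3 := (aux_hasDerivAt_phi a b α23 β23 (q 2 - q 1) (by linarith)).comp_hasFDerivAt q (hl 2 1)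
  have h := (e1.add e2).add e3
  have h' := h.congr_of_eventuallyEq (f₁ := W) (Filter.EventuallyEq.of_eq hWe)
  rw [h'.fderiv]
  fin_cases i <;> simp [auxF] <;> ring

/-- Every maximal solution of the collinear three-particle Hamiltonian
system is global, unique, and preserves the ordering of the particles. -/
theorem collinear_three_particle_global_solution
    (a b : ℝ) (ha : 4 < a) (hab : a < b - 1)
    (m1 m2 m3 : ℝ) (hm1 : 0 < m1) (hm2 : 0 < m2) (hm3 : 0 < m3)
    (α12 α13 α23 β12 β13 β23 : ℝ)
    (hα12 : 0 < α12) (hα13 : 0 < α13) (hα23 : 0 < α23)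
    (hβ12 : 0 < β12) (hβ13 : 0 < β13) (hβ23 : 0 < β23)
    (W : (Fin 3 → ℝ) → ℝ)
    (hW : ∀ q : Fin 3 → ℝ,
      W q = -(α12 * |q 0 - q 1| ^ (-a) + α13 * |q 0 - q 2| ^ (-a)
              + α23 * |q 1 - q 2| ^ (-a))
            + (β12 * |q 0 - q 1| ^ (-b) + β13 * |q 0 - q 2| ^ (-b)
              + β23 * |q 1 - q 2| ^ (-b)))
    (q0 p0 : Fin 3 → ℝ) (hq0 : q0 0 < q0 1) (hq0' : q0 1 < q0 2) :
    ∃! qp : (ℝ → Fin 3 → ℝ) × (ℝ → Fin 3 → ℝ),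
      qp.1 0 = q0 ∧ qp.2 0 = p0 ∧
      (∀ t : ℝ, qp.1 t 0 < qp.1 t 1 ∧ qp.1 t 1 < qp.1 t 2) ∧
      (∀ t : ℝ, ∀ i : Fin 3,
        HasDerivAt (fun τ => qp.1 τ i) (qp.2 t i / ![m1, m2, m3] i) t) ∧
      (∀ t : ℝ, ∀ i : Fin 3,
        HasDerivAt (fun τ => qp.2 τ i)
          (-(fderiv ℝ W (qp.1 t) (Pi.single i 1))) t) := by
  obtain ⟨C1, hC1, hphi1, H1⟩ := aux_pair a b α12 β12 (by linarith) (by linarith) hα12 hβ12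
  obtain ⟨C2, hC2, hphi2, H2⟩ := aux_pair a b α13 β13 (by linarith) (by linarith) hα13 hβ13
  obtain ⟨C3, hC3, hphi3, H3⟩ := aux_pair a b α23 β23 (by linarith) (by linarith) hα23 hβ23
  obtain ⟨E, hE⟩ : ∃ E, E = p0 0 ^ 2 / (2 * m1) + p0 1 ^ 2 / (2 * m2) + p0 2 ^ 2 / (2 * m3)
      + (auxPhi a b α12 β12 (q0 1 - q0 0) + auxPhi a b α13 β13 (q0 2 - q0 0)
        + auxPhi a b α23 β23 (q0 2 - q0 1)) := ⟨_, rfl⟩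
  obtain ⟨d1, hd1, hd1', hs1, ψ1, g1, hψ1, hlo1, hbig1, heq1, hg1, hL1, hB1⟩ :=
    H1 (E + C1 + C2 + C3) (q0 1 - q0 0) (by linarith)
  obtain ⟨d2, hd2, hd2', hs2, ψ2, g2, hψ2, hlo2, hbig2, heq2, hg2, hL2, hB2⟩ :=
    H2 (E + C1 + C2 + C3) (q0 2 - q0 0) (by linarith)
  obtain ⟨d3, hd3, hd3', hs3, ψ3, g3, hψ3, hlo3, hbig3, heq3, hg3, hL3, hB3⟩ :=
    H3 (E + C1 + C2 + C3) (q0 2 - q0 1) (by linarith)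
  have hkin : ∀ x y z : ℝ, 0 ≤ x ^ 2 / (2 * m1) + y ^ 2 / (2 * m2) + z ^ 2 / (2 * m3) := by
    intro x y z
    positivity
  have hFeq : ∀ q : Fin 3 → ℝ, d1 ≤ q 1 - q 0 → d2 ≤ q 2 - q 0 → d3 ≤ q 2 - q 1 →
      auxF (auxDphi a b α12 β12) (auxDphi a b α13 β13) (auxDphi a b α23 β23) q
        = auxF g1 g2 g3 q := by
    intro q k1 k2 k3
    simp only [auxF, hg1 _ k1, hg2 _ k2, hg3 _ k3]
  obtain ⟨K, hK⟩ := aux_F_lip g1 g2 g3 hL1 hL2 hL3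
  obtain ⟨B, hB⟩ := aux_F_bdd g1 g2 g3 hB1 hB2 hB3
  let D : (Fin 3 → ℝ) →L[ℝ] (Fin 3 → ℝ) :=
    ContinuousLinearMap.pi fun i => (![m1, m2, m3] i)⁻¹ •
      ContinuousLinearMap.proj (R := ℝ) (φ := fun _ : Fin 3 => ℝ) i
  have hD : ∀ p i, D p i = p i / ![m1, m2, m3] i := by
    intro p i
    simp [D, div_eq_inv_mul]
  obtain ⟨q, p, hq0e, hp0e, hq, hp⟩ := aux_second_order D (auxF g1 g2 g3) K hK B hB q0 p0
  -- the solution of the modified system stays in the region where the system is unmodified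
  have hqi : ∀ t i, HasDerivAt (fun τ => q τ i) (p t i / ![m1, m2, m3] i) t := by
    intro t i
    rw [← hD]
    exact hasDerivAt_pi.mp (hq t) i
  have hpi : ∀ t i, HasDerivAt (fun τ => p τ i) (auxF g1 g2 g3 (q t) i) t :=
    fun t i => hasDerivAt_pi.mp (hp t) i
  have hgap : ∀ t, d1 < q t 1 - q t 0 ∧ d2 < q t 2 - q t 0 ∧ d3 < q t 2 - q t 1 := by
    intro t
    have hen := aux_energy m1 m2 m3 hm1 hm2 hm3 ψ1 ψ2 ψ3 g1 g2 g3 q p (fun t => hψ1 _)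
      (fun t => hψ2 _) (fun t => hψ3 _) hqi (fun t => hpi t 0) (fun t => hpi t 1)
      (fun t => hpi t 2) t
    rw [hq0e, hp0e, heq1 _ hd1', heq2 _ hd2', heq3 _ hd3', ← hE] at hen
    have hk := hkin (p t 0) (p t 1) (p t 2)
    have l1 := hlo1 (q t 1 - q t 0)
    have l2 := hlo2 (q t 2 - q t 0)
    have l3 := hlo3 (q t 2 - q t 1)
    refine ⟨?_, ?_, ?_⟩
    · by_contra! hc
      linarith [hbig1 _ hc]
    · by_contra! hc
      linarith [hbig2 _ hc]
    · by_contra! hc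
      linarith [hbig3 _ hc]
  refine ⟨(q, p), ⟨hq0e, hp0e, fun t => ?_, hqi, fun t i => ?_⟩, ?_⟩
  · obtain ⟨k1, k2, k3⟩ := hgap t
    constructor
    · show q t 0 < q t 1
      linarith
    · show q t 1 < q t 2
      linarith
  · obtain ⟨k1, k2, k3⟩ := hgap t
    show HasDerivAt (fun τ => p τ i) (-(fderiv ℝ W (q t) (Pi.single i 1))) t
    rw [aux_fderiv a b α12 α13 α23 β12 β13 β23 W hW (q t) (by linarith) (by linarith) i,
      hFeq _ k1.le k2.le k3.le]
    exact hpi t i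
  -- uniqueness
  · rintro ⟨x, y⟩ ⟨hx0, hy0, hord, hx, hy⟩
    simp only at hx0 hy0 hord hx hy
    have hy' : ∀ t i, HasDerivAt (fun τ => y τ i) (auxF (auxDphi a b α12 β12)
        (auxDphi a b α13 β13) (auxDphi a b α23 β23) (x t) i) t := by
      intro t i
      rw [← aux_fderiv a b α12 α13 α23 β12 β13 β23 W hW (x t) (hord t).1 (hord t).2 i]
      exact hy t i
    have r1 : ∀ t, 0 < x t 1 - x t 0 := fun t => by linarith [(hord t).1]
    have r2 : ∀ t, 0 < x t 2 - x t 0 := fun t => by linarith [(hord t).1, (hord t).2]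
    have r3 : ∀ t, 0 < x t 2 - x t 1 := fun t => by linarith [(hord t).2]
    have hgap' : ∀ t, d1 < x t 1 - x t 0 ∧ d2 < x t 2 - x t 0 ∧ d3 < x t 2 - x t 1 := by
      intro t
      have hen := aux_energy m1 m2 m3 hm1 hm2 hm3 (auxPhi a b α12 β12) (auxPhi a b α13 β13)
        (auxPhi a b α23 β23) _ _ _ x y
        (fun t => aux_hasDerivAt_phi _ _ _ _ _ (r1 t))
        (fun t => aux_hasDerivAt_phi _ _ _ _ _ (r2 t))
        (fun t => aux_hasDerivAt_phi _ _ _ _ _ (r3 t)) hx (fun t => hy' t 0) (fun t => hy' t 1)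
        (fun t => hy' t 2) t
      rw [hx0, hy0, ← hE] at hen
      have hk := hkin (y t 0) (y t 1) (y t 2)
      have l1 := hphi1 _ (r1 t)
      have l2 := hphi2 _ (r2 t)
      have l3 := hphi3 _ (r3 t)
      refine ⟨?_, ?_, ?_⟩
      · by_contra! hc
        linarith [hs1 _ (r1 t) hc]
      · by_contra! hc
        linarith [hs2 _ (r2 t) hc]
      · by_contra! hc
        linarith [hs3 _ (r3 t) hc]
    have hxd : ∀ t, HasDerivAt x (D (y t)) t := fun t => hasDerivAt_pi.mpr fun i => by
      rw [hD]
      exact hx t i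
    have hyd : ∀ t, HasDerivAt y (auxF g1 g2 g3 (x t)) t := fun t => hasDerivAt_pi.mpr fun i => by
      obtain ⟨k1, k2, k3⟩ := hgap' t
      rw [← hFeq _ k1.le k2.le k3.le]
      exact hy' t i
    have hlip : LipschitzWith (max (‖D‖₊ * 1) (K * 1))
        (fun z : (Fin 3 → ℝ) × (Fin 3 → ℝ) => (D z.2, auxF g1 g2 g3 z.1)) :=
      (D.lipschitz.comp LipschitzWith.prod_snd).prodMk (hK.comp LipschitzWith.prod_fst)
    have huniq := ODE_solution_unique_univ
      (v := fun _ (z : (Fin 3 → ℝ) × (Fin 3 → ℝ)) => (D z.2, auxF g1 g2 g3 z.1))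
      (s := fun _ => Set.univ) (f := fun t => (x t, y t)) (g := fun t => (q t, p t)) (t₀ := 0)
      (fun t => hlip.lipschitzOnWith) (fun t => ⟨(hxd t).prodMk (hyd t), trivial⟩)
      (fun t => ⟨(hq t).prodMk (hp t), trivial⟩) (by simp [hx0, hy0, hq0e, hp0e])
    refine Prod.ext ?_ ?_
    · funext t
      exact congrArg Prod.fst (congrFun huniq t)
    · funext t
      exact congrArg Prod.snd (congrFun huniq t)
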